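/- arXiv:1407.7720 — 5 statements merged into one kernel-verified Lean document; each statement's English description precedes it below -/
import Mathlib

section
/- Let n ≥ 2, 1 ≤ k ≤ n−1 and m ≥ 1 be integers and p > 0 a real number. Define f_{n,k}(s) = p·(n−k)·C(n−1,n−k)·(ps)^{n−k−1}/(1+ps)^n for s ≥ 0. Then ∫_0^∞ s^m · f_{n,k}(s) ds is finite if and only if m ≤ k−1, and in that case it equals C(n−k+m−1, m) / (p^m · C(k−1, m)). -/
open MeasureTheory

lemma aux_tend (a b : ℕ) : Filter.Tendsto (fun u : ℝ => u ^ a / (1 + u) ^ (a + b + 1))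
    Filter.atTop (nhds 0) := by
  have h0 : Filter.Tendsto (fun u : ℝ => (1 + u)⁻¹) Filter.atTop (nhds 0) :=
    (Filter.tendsto_atTop_add_const_left _ 1 Filter.tendsto_id).inv_tendsto_atTop
  refine tendsto_of_tendsto_of_tendsto_of_le_of_le' tendsto_const_nhds h0 ?_ ?_
  · filter_upwards [Filter.eventually_ge_atTop 0] with u hu
    positivity
  · filter_upwards [Filter.eventually_ge_atTop 0] with u hu
    rw [inv_eq_one_div, div_le_div_iff₀ (by positivity) (by positivity)]
    have h1 : u ^ a ≤ (1 + u) ^ a := by gcongr; linarith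
    have h2 : (1 + u) ^ a ≤ (1 + u) ^ (a + b) := pow_le_pow_right₀ (by linarith) (by omega)
    rw [pow_succ, one_mul]
    exact mul_le_mul_of_nonneg_right (h1.trans h2) (by linarith)

lemma aux_deriv (a N : ℕ) (u : ℝ) (hu : 0 ≤ u) :
    HasDerivAt (fun u : ℝ => u ^ a / (1 + u) ^ N)
      (a * (u ^ (a - 1) / (1 + u) ^ N) - N * (u ^ a / (1 + u) ^ (N + 1))) u := by
  have h1 : (1 + u) ≠ 0 := by positivity
  have h := (hasDerivAt_pow a u).div (((hasDerivAt_id u).const_add 1).pow N)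
    (by simpa using pow_ne_zero N h1)
  convert! h using 1
  rcases N with _ | N
  · simp
  · simp
    field_simp
    ring

lemma aux_beta (a b : ℕ) :
    IntegrableOn (fun u : ℝ => u ^ a / (1 + u) ^ (a + b + 2)) (Set.Ioi 0) ∧
    ∫ u in Set.Ioi (0 : ℝ), u ^ a / (1 + u) ^ (a + b + 2)
      = (a.factorial * b.factorial : ℝ) / (a + b + 1).factorial := by
  induction a with
  | zero =>
    have hd : ∀ x ∈ Set.Ici (0 : ℝ), HasDerivAt
        (fun u : ℝ => (-1 / (b + 1 : ℝ)) * (u ^ 0 / (1 + u) ^ (b + 1)))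
        (x ^ 0 / (1 + x) ^ (0 + b + 2)) x := by
      intro x hx
      convert! (aux_deriv 0 (b + 1) x hx).const_mul (-1 / (b + 1 : ℝ)) using 1
      push_cast
      rw [show 0 + b + 2 = b + 1 + 1 by ring]
      have : (b + 1 : ℝ) ≠ 0 := by positivity
      field_simp
      ring
    have ht := (aux_tend 0 b).const_mul (-1 / (b + 1 : ℝ))
    rw [zero_add, mul_zero] at ht
    have hpos : ∀ x ∈ Set.Ioi (0 : ℝ), 0 ≤ x ^ 0 / (1 + x) ^ (0 + b + 2) := by
      intro x hx
      have : (0 : ℝ) < x := hx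
      positivity
    refine ⟨integrableOn_Ioi_deriv_of_nonneg' hd hpos ht, ?_⟩
    rw [integral_Ioi_of_hasDerivAt_of_nonneg' hd hpos ht]
    simp [Nat.factorial_succ]
    have := Nat.factorial_pos b
    field_simp
  | succ a ih =>
    obtain ⟨hi, hv⟩ := ih
    have hint : IntegrableOn (fun u : ℝ => u ^ (a + 1) / (1 + u) ^ (a + 1 + b + 2))
        (Set.Ioi 0) := by
      refine Integrable.mono' hi ?_ ?_
      · exact Measurable.aestronglyMeasurable (by fun_prop)
      · refine (ae_restrict_iff' measurableSet_Ioi).2 (Filter.Eventually.of_forall ?_)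
        intro u hu
        have hu : (0 : ℝ) < u := hu
        rw [Real.norm_of_nonneg (by positivity), show a + 1 + b + 2 = a + b + 2 + 1 by ring,
          div_le_div_iff₀ (by positivity) (by positivity), pow_succ, pow_succ _ (a + b + 2)]
        have : u ^ a * (1 + u) ^ (a + b + 2) * u ≤ u ^ a * (1 + u) ^ (a + b + 2) * (1 + u) := by
          gcongr; linarith
        linarith
    refine ⟨hint, ?_⟩
    have hd : ∀ x ∈ Set.Ici (0 : ℝ), HasDerivAt
        (fun u : ℝ => u ^ (a + 1) / (1 + u) ^ (a + 1 + b + 1))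
        ((a + 1 : ℝ) * (x ^ a / (1 + x) ^ (a + b + 2)) -
          (a + b + 2 : ℝ) * (x ^ (a + 1) / (1 + x) ^ (a + 1 + b + 2))) x := by
      intro x hx
      convert! (aux_deriv (a + 1) (a + 1 + b + 1) x hx) using 1
      push_cast
      rw [show a + b + 2 = a + 1 + b + 1 by ring]
      ring
    have h := integral_Ioi_of_hasDerivAt_of_tendsto' hd
      ((hi.const_mul _).sub (hint.const_mul _)) (aux_tend (a + 1) b)
    rw [integral_sub (hi.const_mul _) (hint.const_mul _), integral_const_mul,
      integral_const_mul, hv] at h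
    simp only [ne_eq, Nat.add_eq_zero_iff, one_ne_zero, and_false, not_false_eq_true, zero_pow,
      zero_div, sub_zero] at h
    rw [show a + 1 + b + 1 = a + b + 1 + 1 by ring, Nat.factorial_succ a,
      Nat.factorial_succ (a + b + 1)]
    have h2 : (a + b + 2 : ℝ) ≠ 0 := by positivity
    have h3 : ((a + b + 1).factorial : ℝ) ≠ 0 := by positivity
    push_cast
    apply mul_left_cancel₀ h2
    rw [← sub_eq_zero.1 h]
    field_simp
    ring

lemma aux_not (a N : ℕ) (h : N ≤ a + 1) :
    ¬ IntegrableOn (fun u : ℝ => u ^ a / (1 + u) ^ N) (Set.Ioi 0) := by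
  intro hi
  have hi1 := (hi.mono_set (Set.Ioi_subset_Ioi (zero_le_one (α := ℝ)))).const_mul ((2 : ℝ) ^ N)
  have : IntegrableOn (fun u : ℝ => u ^ (-1 : ℝ)) (Set.Ioi 1) := by
    refine Integrable.mono' hi1 ?_ ?_
    · exact Measurable.aestronglyMeasurable (by fun_prop)
    · refine (ae_restrict_iff' measurableSet_Ioi).2 (Filter.Eventually.of_forall ?_)
      intro u hu
      have hu : (1 : ℝ) < u := hu
      have hu0 : (0 : ℝ) < u := by linarith
      rw [Real.norm_of_nonneg (by positivity), Real.rpow_neg_one, inv_eq_one_div, ← mul_div_assoc,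
        div_le_div_iff₀ (by positivity) (by positivity), one_mul, mul_assoc, ← pow_succ]
      calc (1 + u) ^ N ≤ (2 * u) ^ N := by gcongr; linarith
        _ = 2 ^ N * u ^ N := mul_pow _ _ _
        _ ≤ 2 ^ N * u ^ (a + 1) := by gcongr; linarith
  rw [integrableOn_Ioi_rpow_iff zero_lt_one] at this
  exact lt_irrefl _ this

/-- Proposition 2.3: the `m`-th moment of the time to the `k`-th most recent common
ancestor under an infinite time of origin is finite iff `m ≤ k - 1`, with explicit value. -/
theorem stmt_2 (n k m : ℕ) (hn : 2 ≤ n) (hk1 : 1 ≤ k) (hk2 : k ≤ n - 1) (hm : 1 ≤ m)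
    (p : ℝ) (hp : 0 < p) :
    (IntegrableOn
        (fun s : ℝ => s ^ m *
          (p * ((n - k : ℕ) : ℝ) * (Nat.choose (n - 1) (n - k) : ℝ) *
            (p * s) ^ (n - k - 1) / (1 + p * s) ^ n))
        (Set.Ioi 0) ↔ m ≤ k - 1) ∧
    (m ≤ k - 1 →
      ∫ s in Set.Ioi (0 : ℝ), s ^ m *
          (p * ((n - k : ℕ) : ℝ) * (Nat.choose (n - 1) (n - k) : ℝ) *
            (p * s) ^ (n - k - 1) / (1 + p * s) ^ n)
        = (Nat.choose (n - k + m - 1) m : ℝ) / (p ^ m * (Nat.choose (k - 1) m : ℝ))) := by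
  obtain ⟨j, rfl⟩ : ∃ j, k = j + 1 := ⟨k - 1, by omega⟩
  obtain ⟨a, rfl⟩ : ∃ a, n = a + j + 2 := ⟨n - j - 2, by omega⟩
  rw [show a + j + 2 - (j + 1) = a + 1 by omega, show a + j + 2 - 1 = a + j + 1 by omega,
    show a + 1 - 1 = a by omega, show j + 1 - 1 = j by omega,
    show a + 1 + m - 1 = a + m by omega]
  set c : ℝ := p * ((a + 1 : ℕ) : ℝ) * (Nat.choose (a + j + 1) (a + 1) : ℝ) / p ^ m with hc
  have hch : 0 < Nat.choose (a + j + 1) (a + 1) := Nat.choose_pos (by omega)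
  have hc0 : c ≠ 0 := by positivity
  have hf : (fun s : ℝ => s ^ m * (p * ((a + 1 : ℕ) : ℝ) *
      (Nat.choose (a + j + 1) (a + 1) : ℝ) * (p * s) ^ a / (1 + p * s) ^ (a + j + 2)))
      = fun s : ℝ => c * (fun u : ℝ => u ^ (a + m) / (1 + u) ^ (a + j + 2)) (p * s) := by
    funext s
    have : p ^ m ≠ 0 := by positivity
    simp only [hc, pow_add (p * s) a m, mul_pow p s m]
    rw [div_mul_div_comm, ← mul_div_assoc, mul_comm (p ^ m) ((1 + p * s) ^ _),
      show p * ((a + 1 : ℕ) : ℝ) * (Nat.choose (a + j + 1) (a + 1) : ℝ) *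
        ((p * s) ^ a * (p ^ m * s ^ m)) = s ^ m * (p * ((a + 1 : ℕ) : ℝ) *
        (Nat.choose (a + j + 1) (a + 1) : ℝ) * (p * s) ^ a) * p ^ m by ring,
      mul_div_mul_right _ _ this]
  rw [hf]
  constructor
  · have h1 : IntegrableOn (fun s : ℝ => c *
        (fun u : ℝ => u ^ (a + m) / (1 + u) ^ (a + j + 2)) (p * s)) (Set.Ioi 0) ↔
        IntegrableOn (fun u : ℝ => u ^ (a + m) / (1 + u) ^ (a + j + 2)) (Set.Ioi 0) := by
      unfold IntegrableOn
      rw [integrable_const_mul_iff (IsUnit.mk0 c hc0)]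
      have := integrableOn_Ioi_comp_mul_left_iff
        (fun u : ℝ => u ^ (a + m) / (1 + u) ^ (a + j + 2)) 0 hp
      rw [mul_zero] at this
      exact this
    rw [h1]
    constructor
    · intro h
      by_contra hlt
      exact aux_not _ _ (by omega) h
    · intro h
      have := (aux_beta (a + m) (j - m)).1
      rwa [show a + m + (j - m) + 2 = a + j + 2 by omega] at this
  · intro h
    have hv := (aux_beta (a + m) (j - m)).2
    rw [show a + m + (j - m) + 2 = a + j + 2 by omega,
      show a + m + (j - m) + 1 = a + j + 1 by omega] at hv
    rw [integral_const_mul, integral_comp_mul_left_Ioi (fun u : ℝ => u ^ (a + m) / (1 + u) ^ (a + j + 2)) 0 hp, mul_zero, hv, hc]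
    obtain ⟨b, rfl⟩ := Nat.exists_eq_add_of_le h
    rw [Nat.cast_choose ℝ (show a + 1 ≤ a + (m + b) + 1 by omega),
      Nat.cast_choose ℝ (show m ≤ a + m by omega), Nat.cast_choose ℝ h,
      show a + (m + b) + 1 - (a + 1) = m + b by omega, show a + m - m = a by omega,
      show m + b - m = b by omega, Nat.factorial_succ a]
    push_cast
    simp only [smul_eq_mul]
    have e1 : ((a + (m + b) + 1).factorial : ℝ) ≠ 0 := by positivity
    have e2 : ((m + b).factorial : ℝ) ≠ 0 := by positivity
    have e3 : (a.factorial : ℝ) ≠ 0 := by positivity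
    have e4 : (b.factorial : ℝ) ≠ 0 := by positivity
    have e5 : (m.factorial : ℝ) ≠ 0 := by positivity
    have e6 : (a + 1 : ℝ) ≠ 0 := by positivity
    have e7 : p ^ m ≠ 0 := by positivity
    have e8 := hp.ne'
    field_simp
end

section
/- Let n ≥ 2, 1 ≤ k ≤ n−1, 0 ≤ i < n and m ≥ 1 be integers. Then the double integral ∫_0^∞ [s^{n−k−1+m}/(1+s)^n] · ( ∫_s^∞ (t−s)^{k−1}/(t^i (1+t)^{k+1}) dt ) ds is finite if and only if m ≤ k + i. -/
open MeasureTheory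

lemma aux_upper (n k i m : ℕ) (hk1 : 1 ≤ k) (hk2 : k ≤ n - 1) (hi : i < n) (hm : 1 ≤ m)
    (h : m ≤ k + i) (s t : ℝ) (hs : 0 < s) (ht : s < t) :
    s ^ (n - k - 1 + m) / (1 + s) ^ n * ((t - s) ^ (k - 1) / (t ^ i * (1 + t) ^ (k + 1)))
      ≤ (1 + s) ^ (-(3/2) : ℝ) * (1 + t) ^ (-(3/2) : ℝ) := by
  obtain ⟨K, rfl⟩ : ∃ K, k = K + 1 := ⟨k - 1, by omega⟩
  obtain ⟨M, rfl⟩ : ∃ M, n = M + 1 := ⟨n - 1, by omega⟩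
  have ht0 : 0 < t := hs.trans ht
  generalize hN : M + 1 - (K + 1) - 1 + m = N
  have key : s ^ N * t ^ K ≤ (1 + s) ^ M * t ^ i * (1 + t) ^ K := by
    rcases le_total i N with hiN | hiN
    · obtain ⟨d, rfl⟩ := Nat.exists_eq_add_of_le hiN
      have h1 : s ^ i ≤ t ^ i := by gcongr
      have h2 : s ^ d ≤ (1 + s) ^ M :=
        (pow_le_pow_left₀ hs.le (by linarith) d).trans
          (pow_le_pow_right₀ (by linarith) (by omega))
      have h3 : t ^ K ≤ (1 + t) ^ K := by gcongr; linarith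
      calc s ^ (i + d) * t ^ K = s ^ d * s ^ i * t ^ K := by ring
        _ ≤ _ := by gcongr
    · obtain ⟨d, rfl⟩ := Nat.exists_eq_add_of_le hiN
      obtain ⟨e, rfl⟩ : ∃ e, K = d + e := ⟨K - d, by omega⟩
      have h1 : s ^ N ≤ t ^ N := by gcongr
      have h2 : (1:ℝ) ≤ (1 + s) ^ M := one_le_pow₀ (by linarith)
      have h3 : t ^ e ≤ (1 + t) ^ (d + e) :=
        (pow_le_pow_left₀ ht0.le (by linarith) e).trans
          (pow_le_pow_right₀ (by linarith) (by omega))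
      calc s ^ N * t ^ (d + e) = 1 * (s ^ N * t ^ d) * t ^ e := by ring
        _ ≤ (1 + s) ^ M * (t ^ N * t ^ d) * (1 + t) ^ (d + e) := by gcongr
        _ = _ := by ring
  have h4 : (t - s) ^ K ≤ t ^ K := pow_le_pow_left₀ (by linarith) (by linarith) K
  have step : s ^ N / (1 + s) ^ (M + 1) * ((t - s) ^ K / (t ^ i * (1 + t) ^ (K + 1 + 1)))
      ≤ (1 + s)⁻¹ * ((1 + t) ^ 2)⁻¹ := by
    rw [div_mul_div_comm, ← mul_inv, ← one_div, div_le_div_iff₀ (by positivity) (by positivity)]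
    calc s ^ N * (t - s) ^ K * ((1 + s) * (1 + t) ^ 2)
        ≤ s ^ N * t ^ K * ((1 + s) * (1 + t) ^ 2) := by gcongr
      _ ≤ ((1 + s) ^ M * t ^ i * (1 + t) ^ K) * ((1 + s) * (1 + t) ^ 2) := by gcongr
      _ = _ := by ring
  refine step.trans ?_
  have e1 : (1 + s)⁻¹ = (1 + s) ^ (-(3/2) : ℝ) * (1 + s) ^ (1/2 : ℝ) := by
    rw [← Real.rpow_add (by linarith), ← Real.rpow_neg_one]; norm_num
  have e2 : (1 + t) ^ (-(3/2) : ℝ) = (1 + t) ^ (1/2 : ℝ) * ((1 + t) ^ 2)⁻¹ := by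
    rw [← Real.rpow_natCast, ← Real.rpow_neg (by linarith), ← Real.rpow_add (by linarith)]
    norm_num
  rw [e1, e2, mul_assoc]
  have : (1 + s) ^ (1/2 : ℝ) ≤ (1 + t) ^ (1/2 : ℝ) := by gcongr
  gcongr

lemma aux_lower (n k i m : ℕ) (hk1 : 1 ≤ k) (hk2 : k ≤ n - 1)
    (h : k + i < m) (s t : ℝ) (hs : 1 < s) (ht : 2 * s < t) (ht' : t < 3 * s) :
    1 / (2 ^ n * (3 ^ i * 4 ^ (k + 1))) * (s ^ 2)⁻¹ ≤
    s ^ (n - k - 1 + m) / (1 + s) ^ n * ((t - s) ^ (k - 1) / (t ^ i * (1 + t) ^ (k + 1))) := by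
  have hs0 : 0 < s := by linarith
  have ht0 : 0 < t := by linarith
  calc 1 / (2 ^ n * (3 ^ i * 4 ^ (k + 1))) * (s ^ 2)⁻¹
      ≤ s ^ (n - k - 1 + m) / (2 * s) ^ n * (s ^ (k - 1) / ((3 * s) ^ i * (4 * s) ^ (k + 1))) := by
        rw [div_mul_div_comm, ← one_div, div_mul_div_comm,
          div_le_div_iff₀ (by positivity) (by positivity)]
        have : s ^ (n + i + (k + 1)) ≤ s ^ (n - k - 1 + m + (k - 1) + 2) :=
          pow_le_pow_right₀ hs.le (by omega)
        calc _ = 2 ^ n * 3 ^ i * 4 ^ (k + 1) * s ^ (n + i + (k + 1)) := by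
              simp only [mul_pow]; ring
          _ ≤ 2 ^ n * 3 ^ i * 4 ^ (k + 1) * s ^ (n - k - 1 + m + (k - 1) + 2) := by gcongr
          _ = _ := by ring
    _ ≤ _ := by
        have hts : 0 < t - s := by linarith
        have hp : 0 ≤ (t - s) ^ (k - 1) := by positivity
        gcongr <;> linarith

theorem stmt_3 (n k i m : ℕ) (hn : 2 ≤ n) (hk1 : 1 ≤ k) (hk2 : k ≤ n - 1) (hi : i < n)
    (hm : 1 ≤ m) :
    ((∫⁻ s in Set.Ioi (0 : ℝ),
        ENNReal.ofReal (s ^ (n - k - 1 + m) / (1 + s) ^ n) *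
          ∫⁻ t in Set.Ioi s,
            ENNReal.ofReal ((t - s) ^ (k - 1) / (t ^ i * (1 + t) ^ (k + 1)))) ≠ ⊤)
      ↔ m ≤ k + i := by
  constructor
  · intro hfin
    by_contra! h
    apply hfin
    set C : ℝ := 1 / (2 ^ n * (3 ^ i * 4 ^ (k + 1))) with hC
    have hC0 : 0 < C := by positivity
    have hdiv : ∫⁻ s in Set.Ioi (1 : ℝ), ENNReal.ofReal (s⁻¹) = ⊤ := by
      by_contra hne
      apply not_integrableOn_Ioi_inv (a := (1 : ℝ))
      refine ⟨by fun_prop, ?_⟩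
      rw [hasFiniteIntegral_iff_ofReal]
      · exact lt_top_iff_ne_top.mpr hne
      · filter_upwards [ae_restrict_mem measurableSet_Ioi] with s hs
        have : (1:ℝ) < s := hs
        simp only [Pi.zero_apply]
        positivity
    rw [eq_top_iff]
    calc (⊤ : ENNReal) = ENNReal.ofReal C * ∫⁻ s in Set.Ioi (1 : ℝ), ENNReal.ofReal (s⁻¹) := by
          rw [hdiv, ENNReal.mul_top (by simpa using hC0)]
      _ = ∫⁻ s in Set.Ioi (1 : ℝ), ENNReal.ofReal C * ENNReal.ofReal (s⁻¹) :=
          (lintegral_const_mul' _ _ ENNReal.ofReal_ne_top).symm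
      _ ≤ ∫⁻ s in Set.Ioi (1 : ℝ), ENNReal.ofReal (s ^ (n - k - 1 + m) / (1 + s) ^ n) *
          ∫⁻ t in Set.Ioi s,
            ENNReal.ofReal ((t - s) ^ (k - 1) / (t ^ i * (1 + t) ^ (k + 1))) := by
          apply setLIntegral_mono' measurableSet_Ioi
          intro s hs
          have hs1 : (1:ℝ) < s := hs
          have hs0 : 0 < s := by linarith
          rw [← lintegral_const_mul' _ _ ENNReal.ofReal_ne_top]
          calc ENNReal.ofReal C * ENNReal.ofReal (s⁻¹)
              = ∫⁻ t in Set.Ioo (2 * s) (3 * s), ENNReal.ofReal (C * (s ^ 2)⁻¹) := by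
                rw [setLIntegral_const, Real.volume_Ioo, ← ENNReal.ofReal_mul hC0.le,
                  ← ENNReal.ofReal_mul (by positivity)]
                congr 1
                field_simp
                ring
            _ ≤ ∫⁻ t in Set.Ioo (2 * s) (3 * s),
                ENNReal.ofReal (s ^ (n - k - 1 + m) / (1 + s) ^ n) *
                ENNReal.ofReal ((t - s) ^ (k - 1) / (t ^ i * (1 + t) ^ (k + 1))) := by
                apply setLIntegral_mono' measurableSet_Ioo
                intro t ht
                rw [← ENNReal.ofReal_mul (by positivity)]
                exact ENNReal.ofReal_le_ofReal
                  (aux_lower n k i m hk1 hk2 h s t hs1 ht.1 ht.2)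
            _ ≤ _ := by
                apply lintegral_mono_set
                intro t ht
                have := ht.1
                simp only [Set.mem_Ioi]
                linarith
      _ ≤ _ := lintegral_mono_set (Set.Ioi_subset_Ioi zero_le_one)
  · intro h
    have hK : ∫⁻ t : ℝ, ENNReal.ofReal ((1 + ‖t‖) ^ (-(3/2) : ℝ)) < ⊤ :=
      finite_integral_one_add_norm (by simp; norm_num)
    set K := ∫⁻ t : ℝ, ENNReal.ofReal ((1 + ‖t‖) ^ (-(3/2) : ℝ)) with hKdef
    refine ne_top_of_le_ne_top (ENNReal.mul_lt_top hK hK).ne ?_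
    calc _ ≤ ∫⁻ s in Set.Ioi (0 : ℝ), ENNReal.ofReal ((1 + ‖s‖) ^ (-(3/2) : ℝ)) * K := by
          apply setLIntegral_mono' measurableSet_Ioi
          intro s hs
          have hs0 : 0 < s := hs
          rw [← lintegral_const_mul' _ _ ENNReal.ofReal_ne_top, hKdef,
            ← lintegral_const_mul' _ _ ENNReal.ofReal_ne_top]
          refine le_trans (setLIntegral_mono' measurableSet_Ioi ?_) (setLIntegral_le_lintegral (Set.Ioi s) _)
          intro t ht
          have ht' : s < t := ht
          rw [← ENNReal.ofReal_mul (by positivity), ← ENNReal.ofReal_mul (by positivity),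
            Real.norm_of_nonneg hs0.le, Real.norm_of_nonneg (hs0.trans ht').le]
          exact ENNReal.ofReal_le_ofReal (aux_upper n k i m hk1 hk2 hi hm h s t hs0 ht')
      _ ≤ ∫⁻ s : ℝ, ENNReal.ofReal ((1 + ‖s‖) ^ (-(3/2) : ℝ)) * K :=
          setLIntegral_le_lintegral _ _
      _ = K * K := lintegral_mul_const' _ _ hK.ne
end

section
/- Let n ≥ 2 and 1 ≤ k ≤ n−1 be integers, p > 0 and θ ≥ 0 real numbers. Define F_t(x) = ((1+pt)/(pt)) · (p·min(x,t))/(1+p·min(x,t)) for x ≥ 0 and t > 0, and h_n^(0)(t) = p·n·(pt)^{n−1}/(1+pt)^{n+1} for t > 0. Then θ·[ (n−k−1)·∫_0^∞ ∫_0^∞ h_n^(0)(t)·(1−F_t(x))^2·F_t(x)^{k−1} dt dx + 2·∫_0^∞ ∫_0^∞ h_n^(0)(t)·(1−F_t(x))·F_t(x)^{k−1} dt dx ] = n·θ/(k·p). -/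
open MeasureTheory

/-- The common cumulative distribution function of the node depths of the coalescent point
process of a sample of size `n`, with fixed time of origin `t` and sampling rate `p`. -/
noncomputable def cdfF (p t x : ℝ) : ℝ :=
  ((1 + p * t) / (p * t)) * (p * min x t) / (1 + p * min x t)

open Set Filter Topology in
lemma aux_sub_tendsto (p : ℝ) (hp : 0 < p) :
    Tendsto (fun t : ℝ => p * t / (1 + p * t)) atTop (𝓝 1) := by
  have h1 : Tendsto (fun t : ℝ => 1 + p * t) atTop atTop :=
    tendsto_atTop_add_const_left _ _ (tendsto_id.const_mul_atTop hp)
  have h2 : Tendsto (fun t : ℝ => 1 - (1 + p * t)⁻¹) atTop (𝓝 (1 - 0)) :=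
    tendsto_const_nhds.sub (tendsto_inv_atTop_zero.comp h1)
  rw [sub_zero] at h2
  refine h2.congr' ?_
  filter_upwards [eventually_gt_atTop 0] with t ht
  have : 0 < 1 + p * t := by positivity
  field_simp
  ring

lemma aux_sub_deriv (p t : ℝ) (hp : 0 < p) (ht : 0 ≤ t) :
    HasDerivAt (fun t : ℝ => p * t / (1 + p * t)) (p / (1 + p * t) ^ 2) t := by
  have h0 : 1 + p * t ≠ 0 := by positivity
  have h1 : HasDerivAt (fun t : ℝ => p * t) p t := by
    simpa using (hasDerivAt_id t).const_mul p
  have h2 := h1.div (h1.const_add 1) h0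
  refine h2.congr_deriv ?_
  congr 1
  ring

lemma aux_F_ge (p t x : ℝ) (hp : 0 < p) (ht : 0 < t) (h : t ≤ x) : cdfF p t x = 1 := by
  unfold cdfF
  rw [min_eq_right h]
  have : 0 < 1 + p * t := by positivity
  field_simp

lemma aux_F_lt (p t x : ℝ) (h : x ≤ t) :
    cdfF p t x = (p * x / (1 + p * x)) / (p * t / (1 + p * t)) := by
  unfold cdfF
  rw [min_eq_left h]
  rw [div_div_eq_mul_div, div_mul_eq_mul_div, div_mul_eq_mul_div, div_right_comm]
  ring

lemma aux_F_mem (p t x : ℝ) (hp : 0 < p) (ht : 0 < t) (hx : 0 < x) :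
    0 ≤ cdfF p t x ∧ cdfF p t x ≤ 1 := by
  rcases le_total t x with h | h
  · rw [aux_F_ge p t x hp ht h]; norm_num
  · rw [aux_F_lt p t x h]
    refine ⟨by positivity, ?_⟩
    rw [div_le_one (by positivity), div_le_div_iff₀ (by positivity) (by positivity)]
    nlinarith

lemma aux_F_meas (p : ℝ) : Measurable (fun z : ℝ × ℝ => cdfF p z.2 z.1) := by
  unfold cdfF
  fun_prop

noncomputable def auxf (m j e : ℕ) (p x t : ℝ) : ℝ :=
  (p * ((m + j + 2 : ℕ) : ℝ) * (p * t) ^ (m + j + 1) / (1 + p * t) ^ (m + j + 3)) *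
              (1 - cdfF p t x) ^ e * cdfF p t x ^ j

lemma auxf_meas (m j e : ℕ) (p : ℝ) : Measurable (fun z : ℝ × ℝ => auxf m j e p z.1 z.2) := by
  unfold auxf
  have := aux_F_meas p
  fun_prop

lemma auxf_nonneg (m j e : ℕ) (p x t : ℝ) (hp : 0 < p) (hx : 0 < x) (ht : 0 < t) :
    0 ≤ auxf m j e p x t := by
  unfold auxf
  obtain ⟨h1, h2⟩ := aux_F_mem p t x hp ht hx
  have : 0 ≤ 1 - cdfF p t x := by linarith
  positivity

lemma auxf_zero (m j e : ℕ) (he : e ≠ 0) (p x t : ℝ) (hp : 0 < p) (ht : 0 < t) (h : t ≤ x) :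
    auxf m j e p x t = 0 := by
  unfold auxf
  rw [aux_F_ge p t x hp ht h]
  simp [he]

lemma auxf_comb (m j : ℕ) (p x t : ℝ) (hp : 0 < p) (hx : 0 < x) (ht : x ≤ t) :
    HasDerivAt (fun t : ℝ => ((m + j + 2 : ℕ) : ℝ) * (p * x / (1 + p * x)) ^ j *
      ((p * t / (1 + p * t)) ^ m * (p * t / (1 + p * t) - p * x / (1 + p * x)) ^ 2))
      (m * auxf m j 2 p x t + 2 * auxf m j 1 p x t) t := by
  have ht0 : 0 < t := by linarith
  have hs := aux_sub_deriv p t hp ht0.le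
  have h := ((hs.pow m).mul ((hs.sub_const (p * x / (1 + p * x))).pow 2)).const_mul
    (((m + j + 2 : ℕ) : ℝ) * (p * x / (1 + p * x)) ^ j)
  refine h.congr_deriv ?_
  unfold auxf
  rw [aux_F_lt p t x ht]
  have e1 : p * ((m + j + 2 : ℕ) : ℝ) * (p * t) ^ (m + j + 1) / (1 + p * t) ^ (m + j + 3)
    = ((m + j + 2 : ℕ) : ℝ) * (p * t / (1 + p * t)) ^ (m + j + 1) * (p / (1 + p * t) ^ 2) := by
    have : 0 < 1 + p * t := by positivity
    rw [div_pow]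
    field_simp
    ring
  rw [e1]
  have hs0 : 0 < p * t / (1 + p * t) := by positivity
  simp only [Pi.pow_apply]
  generalize p * t / (1 + p * t) = s at *
  generalize p * x / (1 + p * x) = y at *
  generalize p / (1 + p * t) ^ 2 = q at *
  generalize ((m + j + 2 : ℕ) : ℝ) = N at *
  rw [div_pow]
  rcases m with _ | m
  · simp
    field_simp
    ring
  · simp only [Nat.add_sub_cancel]
    push_cast
    field_simp
    ring

open Set Filter Topology in
lemma aux_inner (m j : ℕ) (p x : ℝ) (hp : 0 < p) (hx : 0 < x) :
    m * (∫ t in Ioi (0:ℝ), auxf m j 2 p x t) + 2 * (∫ t in Ioi (0:ℝ), auxf m j 1 p x t)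
      = ((m + j + 2 : ℕ) : ℝ) * (p * x / (1 + p * x)) ^ j * (1 / (1 + p * x)) ^ 2 := by
  have hr : ∀ e : ℕ, e ≠ 0 → ∫ t in Ioi (0:ℝ), auxf m j e p x t
      = ∫ t in Ioi x, auxf m j e p x t := by
    intro e he
    refine setIntegral_eq_of_subset_of_forall_sdiff_eq_zero measurableSet_Ioi
      (Ioi_subset_Ioi hx.le) ?_
    intro t ht
    exact auxf_zero m j e he p x t hp ht.1 (not_lt.1 ht.2)
  rw [hr 2 (by norm_num), hr 1 (by norm_num)]
  have hd := fun t (ht : t ∈ Ioi x) => auxf_comb m j p x t hp hx (le_of_lt ht)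
  have hnn : ∀ e, ∀ t ∈ Ioi x, 0 ≤ auxf m j e p x t := fun e t ht =>
    auxf_nonneg m j e p x t hp hx (hx.trans ht)
  have hc := (auxf_comb m j p x x hp hx le_rfl).continuousAt.continuousWithinAt (s := Ici x)
  have hpos : ∀ t ∈ Ioi x, 0 ≤ m * auxf m j 2 p x t + 2 * auxf m j 1 p x t := by
    intro t ht
    have := hnn 2 t ht
    have := hnn 1 t ht
    positivity
  have hs := aux_sub_tendsto p hp
  have hlim := ((hs.pow m).mul ((hs.sub_const (p * x / (1 + p * x))).pow 2)).const_mul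
    (((m + j + 2 : ℕ) : ℝ) * (p * x / (1 + p * x)) ^ j)
  have hint := integrableOn_Ioi_deriv_of_nonneg hc hd hpos hlim
  have hval := integral_Ioi_of_hasDerivAt_of_nonneg hc hd hpos hlim
  have hm1 : Measurable (fun t => auxf m j 1 p x t) :=
    (auxf_meas m j 1 p).comp (measurable_prodMk_left (x := x))
  have i1 : IntegrableOn (fun t => 2 * auxf m j 1 p x t) (Ioi x) := by
    refine Integrable.mono' hint (hm1.const_mul 2).aestronglyMeasurable ?_
    filter_upwards [ae_restrict_mem measurableSet_Ioi] with t ht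
    have h1 := hnn 2 t ht
    have h2 := hnn 1 t ht
    rw [Real.norm_of_nonneg (by positivity)]
    have : 0 ≤ (m:ℝ) * auxf m j 2 p x t := by positivity
    linarith
  have i2 : IntegrableOn (fun t => (m:ℝ) * auxf m j 2 p x t) (Ioi x) := by
    have := hint.sub i1
    refine this.congr (Eventually.of_forall fun t => ?_)
    simp
  rw [← integral_const_mul, ← integral_const_mul, ← integral_add i2 i1, hval]
  have : 0 < 1 + p * x := by positivity
  have e : 1 - p * x / (1 + p * x) = 1 / (1 + p * x) := by field_simp; ring
  rw [e]
  simp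

open Set Filter Topology in
lemma aux_outer (m j : ℕ) (p : ℝ) (hp : 0 < p) :
    m * (∫ x in Ioi (0:ℝ), ∫ t in Ioi (0:ℝ), auxf m j 2 p x t)
      + 2 * (∫ x in Ioi (0:ℝ), ∫ t in Ioi (0:ℝ), auxf m j 1 p x t)
      = ((m + j + 2 : ℕ) : ℝ) / ((j + 1 : ℕ) * p) := by
  have hnn : ∀ e, ∀ x ∈ Ioi (0:ℝ), 0 ≤ ∫ t in Ioi (0:ℝ), auxf m j e p x t := fun e x hx =>
    setIntegral_nonneg measurableSet_Ioi fun t ht => auxf_nonneg m j e p x t hp hx ht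
  have hd : ∀ x ∈ Ici (0:ℝ), HasDerivAt (fun x : ℝ => ((m + j + 2 : ℕ) : ℝ) / ((j + 1 : ℕ) * p) *
      (p * x / (1 + p * x)) ^ (j + 1))
      (((m + j + 2 : ℕ) : ℝ) * (p * x / (1 + p * x)) ^ j * (1 / (1 + p * x)) ^ 2) x := by
    intro x hx
    have hx : 0 ≤ x := hx
    refine (((aux_sub_deriv p x hp hx).pow (j + 1)).const_mul
      (((m + j + 2 : ℕ) : ℝ) / ((j + 1 : ℕ) * p))).congr_deriv ?_
    have : 0 < 1 + p * x := by positivity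
    simp only [Nat.add_sub_cancel]
    generalize (p * x / (1 + p * x)) ^ j = Y
    have : ((j + 1 : ℕ) : ℝ) ≠ 0 := by positivity
    field_simp
  have hc := (hd 0 self_mem_Ici).continuousAt.continuousWithinAt (s := Ici 0)
  have hd' := fun x (hx : x ∈ Ioi (0:ℝ)) => hd x (mem_Ici.2 (le_of_lt hx))
  have hpos : ∀ x ∈ Ioi (0:ℝ), 0 ≤ ((m + j + 2 : ℕ) : ℝ) * (p * x / (1 + p * x)) ^ j *
      (1 / (1 + p * x)) ^ 2 := by
    intro x hx
    have hx : 0 < x := hx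
    positivity
  have hlim := ((aux_sub_tendsto p hp).pow (j + 1)).const_mul
    (((m + j + 2 : ℕ) : ℝ) / ((j + 1 : ℕ) * p))
  have hint := integrableOn_Ioi_deriv_of_nonneg hc hd' hpos hlim
  have hval := integral_Ioi_of_hasDerivAt_of_nonneg hc hd' hpos hlim
  have hm1 : StronglyMeasurable (fun x => ∫ t in Ioi (0:ℝ), auxf m j 1 p x t) :=
    (auxf_meas m j 1 p).stronglyMeasurable.integral_prod_right
  have i1 : IntegrableOn (fun x => 2 * ∫ t in Ioi (0:ℝ), auxf m j 1 p x t) (Ioi 0) := by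
    refine Integrable.mono' hint (hm1.const_mul 2).aestronglyMeasurable ?_
    filter_upwards [ae_restrict_mem measurableSet_Ioi] with x hx
    have h1 := hnn 2 x hx
    have h2 := hnn 1 x hx
    rw [Real.norm_of_nonneg (by positivity), ← aux_inner m j p x hp hx]
    have := mul_nonneg (Nat.cast_nonneg (α := ℝ) m) h1
    linarith
  have i2 : IntegrableOn (fun x => (m:ℝ) * ∫ t in Ioi (0:ℝ), auxf m j 2 p x t) (Ioi 0) := by
    have := hint.sub i1
    refine this.congr ?_
    filter_upwards [ae_restrict_mem measurableSet_Ioi] with x hx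
    simp only [Pi.sub_apply]
    rw [← aux_inner m j p x hp hx]
    ring
  rw [← integral_const_mul, ← integral_const_mul, ← integral_add i2 i1,
    setIntegral_congr_fun measurableSet_Ioi (fun x hx => aux_inner m j p x hp hx), hval]
  simp

/-- Proposition 3.4: the expected site frequency spectrum under the uniform prior on the
time of origin equals `n θ / (k p)` (the Kingman coalescent spectrum). -/
theorem stmt_8 (n k : ℕ) (hn : 2 ≤ n) (hk1 : 1 ≤ k) (hk2 : k ≤ n - 1)
    (p θ : ℝ) (hp : 0 < p) (hθ : 0 ≤ θ) :
    θ * (((n : ℝ) - k - 1) *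
          (∫ x in Set.Ioi (0 : ℝ), ∫ t in Set.Ioi (0 : ℝ),
            (p * n * (p * t) ^ (n - 1) / (1 + p * t) ^ (n + 1)) *
              (1 - cdfF p t x) ^ 2 * cdfF p t x ^ (k - 1))
        + 2 * ∫ x in Set.Ioi (0 : ℝ), ∫ t in Set.Ioi (0 : ℝ),
            (p * n * (p * t) ^ (n - 1) / (1 + p * t) ^ (n + 1)) *
              (1 - cdfF p t x) * cdfF p t x ^ (k - 1))
      = (n : ℝ) * θ / (k * p) := by
  obtain ⟨j, rfl⟩ : ∃ j, k = j + 1 := ⟨k - 1, by omega⟩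
  obtain ⟨m, rfl⟩ : ∃ m, n = m + j + 2 := ⟨n - j - 2, by omega⟩
  have h := aux_outer m j p hp
  simp only [auxf, pow_one] at h
  have e1 : ((m + j + 2 : ℕ) : ℝ) - ((j + 1 : ℕ) : ℝ) - 1 = m := by push_cast; ring
  have e2 : m + j + 2 - 1 = m + j + 1 := by omega
  have e3 : m + j + 2 + 1 = m + j + 3 := by omega
  rw [e1, e2, e3, Nat.add_sub_cancel, h]
  ring
end

section
/- Let α > 0 and t > 0 be real numbers and i ≥ 0 an integer. Then lim_{n→∞} (n/α)·n·C(n−1,i)·(nt/α)^{n−i−1}/(1+nt/α)^{n+1} = α^{i+1}·e^{−α/t}/(i!·t^{i+2}). -/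
/-- Proposition 4.5: pointwise convergence of the posterior densities `h_n^(i)(t)` (with
sampling parameter `p = n/α`) towards the inverse-gamma density with parameters `(i+1, α)`. -/
theorem stmt_11 (α t : ℝ) (hα : 0 < α) (ht : 0 < t) (i : ℕ) :
    Filter.Tendsto
      (fun n : ℕ => ((n : ℝ) / α) * n * (Nat.choose (n - 1) i : ℝ) *
        ((n : ℝ) * t / α) ^ (n - i - 1) / (1 + (n : ℝ) * t / α) ^ (n + 1))
      Filter.atTop
      (nhds (α ^ (i + 1) * Real.exp (-α / t) / ((Nat.factorial i : ℝ) * t ^ (i + 2)))) := by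
  have hC0 : Filter.Tendsto (fun n : ℕ => (n.choose i : ℝ) * (1 / ((n : ℝ) + 1)) ^ i)
      Filter.atTop (nhds (1 ^ i / (i.factorial : ℝ))) := by
    apply ProbabilityTheory.tendsto_choose_mul_pow_atTop
    have := tendsto_natCast_div_add_atTop (𝕜 := ℝ) 1
    simpa [div_eq_mul_inv] using this
  have hC : Filter.Tendsto (fun n : ℕ => ((n - 1).choose i : ℝ) * (1 / (n : ℝ)) ^ i)
      Filter.atTop (nhds (1 ^ i / (i.factorial : ℝ))) := by
    rw [← Filter.tendsto_add_atTop_iff_nat 1]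
    simpa using hC0
  have hE := Real.tendsto_one_add_div_pow_exp (α / t)
  have hO : Filter.Tendsto (fun n : ℕ => 1 + (α / t) / (n : ℝ)) Filter.atTop (nhds (1 + 0)) :=
    (tendsto_const_div_atTop_nhds_zero_nat (α / t)).const_add 1
  have key := ((hC.const_mul (1 / α)).mul_const ((α / t) ^ (i + 2))).div (hE.mul hO)
    (by simp [Real.exp_ne_zero])
  have hl : 1 / α * (1 ^ i / (i.factorial : ℝ)) * (α / t) ^ (i + 2) /
      (Real.exp (α / t) * (1 + 0)) =
      α ^ (i + 1) * Real.exp (-α / t) / ((Nat.factorial i : ℝ) * t ^ (i + 2)) := by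
    have := Nat.factorial_ne_zero i
    have := Real.exp_ne_zero (α / t)
    rw [neg_div, Real.exp_neg, one_pow, div_pow]
    field_simp
    ring
  rw [hl] at key
  refine key.congr' ?_
  filter_upwards [Filter.eventually_ge_atTop (i + 1)] with n hn
  obtain ⟨m, rfl⟩ := Nat.exists_eq_add_of_le hn
  have e1 : i + 1 + m - i - 1 = m := by omega
  rw [e1]
  simp only [Pi.div_apply]
  have hN : (0 : ℝ) < ((i + 1 + m : ℕ) : ℝ) := by positivity
  generalize ((i + 1 + m : ℕ) : ℝ) = N at *
  generalize (((i + 1 + m - 1).choose i : ℕ) : ℝ) = C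
  have h1 : 1 + N * t / α = (N * t / α) * (1 + α / t / N) := by field_simp; ring
  have hx : 0 < N * t / α := by positivity
  have hy : 0 < 1 + α / t / N := by positivity
  have h2 : (α / t) = N / (N * t / α) := by field_simp
  have h3 : N / α * N = 1 / α * N ^ 2 := by ring
  rw [h1, h3]
  generalize 1 + α / t / N = y at *
  rw [h2]
  generalize N * t / α = x at *
  rw [mul_pow, div_pow, div_pow, one_pow]
  field_simp
  ring
end

section
/- Let α > 0 and t > 0 be real numbers and n > i ≥ 0 integers. Then (n/α)·n·C(n−1,i)·(nt/α)^{n−i−1}/(1+nt/α)^{n+1} ≤ α^{i+1}/(i!·t^{i+2}). -/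
/-- Equation (7) of the paper: uniform domination bound on the posterior densities
`h_n^(i)(t)` (with sampling parameter `p = n/α`). -/
theorem stmt_13 (α t : ℝ) (hα : 0 < α) (ht : 0 < t) (n i : ℕ) (hi : i < n) :
    ((n : ℝ) / α) * n * (Nat.choose (n - 1) i : ℝ) * ((n : ℝ) * t / α) ^ (n - i - 1)
        / (1 + (n : ℝ) * t / α) ^ (n + 1)
      ≤ α ^ (i + 1) / ((Nat.factorial i : ℝ) * t ^ (i + 2)) := by
  have hn : (0 : ℝ) < n := by exact_mod_cast (Nat.zero_le i).trans_lt hi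
  have hx : 0 < (n : ℝ) * t / α := by positivity
  have hC : (Nat.choose (n - 1) i : ℝ) * (Nat.factorial i : ℝ) ≤ (n : ℝ) ^ i := by
    have h := Nat.choose_le_pow_div (α := ℝ) i (n - 1)
    rw [le_div_iff₀ (by positivity)] at h
    refine h.trans ?_
    gcongr
    exact Nat.sub_le n 1
  have hp : ((n : ℝ) * t / α) ^ (n + 1) ≤ (1 + (n : ℝ) * t / α) ^ (n + 1) := by
    gcongr
    linarith
  have hs : ((n : ℝ) * t / α) ^ (n + 1)
      = ((n : ℝ) * t / α) ^ (n - i - 1) * ((n : ℝ) * t / α) ^ (i + 2) := by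
    rw [← pow_add]
    congr 1
    omega
  rw [div_le_div_iff₀ (by positivity) (by positivity)]
  calc _ = ((n : ℝ) / α) * n * ((n : ℝ) * t / α) ^ (n - i - 1) * t ^ (i + 2)
        * ((Nat.choose (n - 1) i : ℝ) * (Nat.factorial i : ℝ)) := by ring
    _ ≤ ((n : ℝ) / α) * n * ((n : ℝ) * t / α) ^ (n - i - 1) * t ^ (i + 2) * (n : ℝ) ^ i := by
        gcongr
    _ = α ^ (i + 1) * ((n : ℝ) * t / α) ^ (n + 1) := by
        rw [hs]
        generalize ((n : ℝ) * t / α) ^ (n - i - 1) = y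
        rw [div_pow, mul_pow]
        field_simp
        ring
    _ ≤ _ := by gcongr
end
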